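/- Let Ω ⊆ ℝ³ be open, and let ρ : Ω → ℝ with ρ > 0, u = (u₁,u₂,u₃) : Ω → ℝ³ with u₁ > 0, and φ : Ω → ℝ be C² functions satisfying the steady Euler–Poisson continuity equation ∂₁(ρu₁)+∂₂(ρu₂)+∂₃(ρu₃) = 0 and momentum equations ∂₁(ρu_iu₁)+∂₂(ρu_iu₂)+∂₃(ρu_iu₃)+∂_i(p(ρ)) = ρ∂_iφ for i = 1,2,3. Set β₂ = u₂/u₁, β₃ = u₃/u₁, G = 1 + β₂² + β₃², D = ∂₁ + β₂∂₂ + β₃∂₃, W = ∂₂β₃ − ∂₃β₂ + β₃∂₁β₂ − β₂∂₁β₃, c²(ρ) = p'(ρ), and B = ½(u₁²+u₂²+u₃²) + h(ρ) − φ. Then at every point of Ω (note B + φ − h(ρ) = ½|u|² > 0): D(W/(ρG)) + (1/(2ρ(B+φ−h(ρ))²))·[(1,β₂,β₃)·(((c²(ρ)/ρ)∇ρ − ∇φ) × ∇B)] = 0. -/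

import Mathlib

open Real Set MeasureTheory

/-- The `i`-th partial derivative of a function on `ℝ³`. -/
noncomputable def pd (i : Fin 3) (f : (Fin 3 → ℝ) → ℝ) (x : Fin 3 → ℝ) : ℝ :=
  fderiv ℝ f x (Pi.single i 1)

/-- The slope `β₂ = u₂/u₁`. -/
noncomputable def beta2 (u1 u2 : (Fin 3 → ℝ) → ℝ) : (Fin 3 → ℝ) → ℝ :=
  fun x => u2 x / u1 x

/-- The slope `β₃ = u₃/u₁`. -/
noncomputable def beta3 (u1 u3 : (Fin 3 → ℝ) → ℝ) : (Fin 3 → ℝ) → ℝ :=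
  fun x => u3 x / u1 x

/-- `G = 1 + β₂² + β₃²`. -/
noncomputable def Gfun (u1 u2 u3 : (Fin 3 → ℝ) → ℝ) : (Fin 3 → ℝ) → ℝ :=
  fun x => 1 + (beta2 u1 u2 x) ^ 2 + (beta3 u1 u3 x) ^ 2

/-- `W = ∂₂β₃ − ∂₃β₂ + β₃∂₁β₂ − β₂∂₁β₃`. -/
noncomputable def Wfun (u1 u2 u3 : (Fin 3 → ℝ) → ℝ) : (Fin 3 → ℝ) → ℝ :=
  fun x => pd 1 (beta3 u1 u3) x - pd 2 (beta2 u1 u2) x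
    + beta3 u1 u3 x * pd 0 (beta2 u1 u2) x - beta2 u1 u2 x * pd 0 (beta3 u1 u3) x

/-- The transport operator `D = ∂₁ + β₂∂₂ + β₃∂₃`. -/
noncomputable def Dop (u1 u2 u3 : (Fin 3 → ℝ) → ℝ) (f : (Fin 3 → ℝ) → ℝ)
    (x : Fin 3 → ℝ) : ℝ :=
  pd 0 f x + beta2 u1 u2 x * pd 1 f x + beta3 u1 u3 x * pd 2 f x

/-- The Bernoulli function `B = ½(u₁²+u₂²+u₃²) + h(ρ) − φ`. -/
noncomputable def Bfun (ρ u1 u2 u3 φ : (Fin 3 → ℝ) → ℝ) (h : ℝ → ℝ) :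
    (Fin 3 → ℝ) → ℝ :=
  fun x => (1 / 2) * ((u1 x) ^ 2 + (u2 x) ^ 2 + (u3 x) ^ 2) + h (ρ x) - φ x


section helpers
variable {x : Fin 3 → ℝ} {f g a b c a' b' c' : (Fin 3 → ℝ) → ℝ}

lemma pd_mul (i : Fin 3) (hf : DifferentiableAt ℝ f x) (hg : DifferentiableAt ℝ g x) :
    pd i (fun y => f y * g y) x = pd i f x * g x + f x * pd i g x := by
  unfold pd
  rw [fderiv_fun_mul hf hg]
  simp
  ring

lemma pd_add (i : Fin 3) (hf : DifferentiableAt ℝ f x) (hg : DifferentiableAt ℝ g x) :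
    pd i (fun y => f y + g y) x = pd i f x + pd i g x := by
  unfold pd
  rw [fderiv_fun_add hf hg]
  simp

lemma pd_sub (i : Fin 3) (hf : DifferentiableAt ℝ f x) (hg : DifferentiableAt ℝ g x) :
    pd i (fun y => f y - g y) x = pd i f x - pd i g x := by
  unfold pd
  rw [fderiv_fun_sub hf hg]
  simp

lemma pd_congr (i : Fin 3) (hfg : f =ᶠ[nhds x] g) : pd i f x = pd i g x := by
  unfold pd
  rw [hfg.fderiv_eq]

lemma pd_const (i : Fin 3) (k : ℝ) : pd i (fun _ => k) x = 0 := by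
  simp [pd]

lemma pd_comp (i : Fin 3) {F : ℝ → ℝ} {F' : ℝ} (hF : HasDerivAt F F' (f x))
    (hf : DifferentiableAt ℝ f x) : pd i (fun y => F (f y)) x = F' * pd i f x := by
  unfold pd
  have := hF.comp_hasFDerivAt x hf.hasFDerivAt
  have h2 : fderiv ℝ (fun y => F (f y)) x = F' • fderiv ℝ f x := this.fderiv
  rw [h2]
  simp

lemma pd_div (i : Fin 3) (hf : DifferentiableAt ℝ f x) (hg : DifferentiableAt ℝ g x)
    (h0 : g x ≠ 0) :
    pd i (fun y => f y / g y) x = (pd i f x * g x - f x * pd i g x) / (g x) ^ 2 := by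
  have hq : DifferentiableAt ℝ (fun y => f y / g y) x := by
    simpa only [div_eq_mul_inv] using hf.fun_mul (hg.fun_inv h0)
  have h1 := pd_mul i hq hg
  have h2 : pd i (fun y => f y / g y * g y) x = pd i f x := by
    apply pd_congr
    filter_upwards [hg.continuousAt.eventually_ne h0] with y hy
    field_simp
  rw [h2] at h1
  rw [h1]
  field_simp
  ring

lemma pd_dot (i : Fin 3) (ha : DifferentiableAt ℝ a x) (hb : DifferentiableAt ℝ b x)
    (hc : DifferentiableAt ℝ c x) (ha' : DifferentiableAt ℝ a' x)
    (hb' : DifferentiableAt ℝ b' x) (hc' : DifferentiableAt ℝ c' x) :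
    pd i (fun y => a y * a' y + b y * b' y + c y * c' y) x
      = (pd i a x * a' x + a x * pd i a' x) + (pd i b x * b' x + b x * pd i b' x)
        + (pd i c x * c' x + c x * pd i c' x) := by
  rw [pd_add i ((ha.fun_mul ha').fun_add (hb.fun_mul hb')) (hc.fun_mul hc'),
    pd_add i (ha.fun_mul ha') (hb.fun_mul hb'), pd_mul i ha ha', pd_mul i hb hb', pd_mul i hc hc']

lemma pd_differentiableAt (i : Fin 3) (hf : ContDiffAt ℝ 2 f x) :
    DifferentiableAt ℝ (pd i f) x := by
  have h1 : ContDiffAt ℝ 1 (fderiv ℝ f) x := hf.fderiv_right (by norm_num)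
  have h2 := h1.differentiableAt (by norm_num)
  exact h2.clm_apply (differentiableAt_const _)

lemma pd_symm (i j : Fin 3) (hf : ContDiffAt ℝ 2 f x) :
    pd i (pd j f) x = pd j (pd i f) x := by
  have h1 : ContDiffAt ℝ 1 (fderiv ℝ f) x := hf.fderiv_right (by norm_num)
  have h2 := h1.differentiableAt (by norm_num)
  have key : ∀ k l : Fin 3, pd k (pd l f) x
      = fderiv ℝ (fderiv ℝ f) x (Pi.single k 1) (Pi.single l 1) := by
    intro k l
    change fderiv ℝ (fun y => fderiv ℝ f y (Pi.single l 1)) x (Pi.single k 1) = _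
    rw [fderiv_clm_apply h2 (differentiableAt_const _)]
    simp
  rw [key, key]
  exact hf.isSymmSndFDerivAt (by simp) _ _

lemma final_alg (a b c R Q P0 P1 P2 T0 T1 T2 : ℝ) (ha : a ≠ 0) (hR : R ≠ 0) (hQ : Q ≠ 0)
    (key : a * P0 + b * P1 + c * P2 + 2 * R * (a * T0 + b * T1 + c * T2) = 0) :
    P0 / (R * Q) ^ 2 + b / a * (P1 / (R * Q) ^ 2) + c / a * (P2 / (R * Q) ^ 2)
      + 1 / (2 * R * (Q / 2) ^ 2) * (T0 + b / a * T1 + c / a * T2) = 0 := by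
  have e : P0 / (R * Q) ^ 2 + b / a * (P1 / (R * Q) ^ 2) + c / a * (P2 / (R * Q) ^ 2)
      + 1 / (2 * R * (Q / 2) ^ 2) * (T0 + b / a * T1 + c / a * T2)
      = (a * P0 + b * P1 + c * P2 + 2 * R * (a * T0 + b * T1 + c * T2)) / (a * (R * Q) ^ 2) := by
    field_simp
  rw [e, key, zero_div]

end helpers

/-- The transport equation (2.6) for the quantity `W/(ρG)`:
`D(W/(ρG)) + (1/(2ρ(B+φ−h(ρ))²)) (1,β₂,β₃)·(((c²(ρ)/ρ)∇ρ − ∇φ) × ∇B) = 0`. -/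
theorem transport_equation_for_W
    (Ω : Set (Fin 3 → ℝ)) (hΩ : IsOpen Ω)
    (ρ u1 u2 u3 φ : (Fin 3 → ℝ) → ℝ)
    (p p' h : ℝ → ℝ)
    (hρpos : ∀ x ∈ Ω, 0 < ρ x)
    (hu1pos : ∀ x ∈ Ω, 0 < u1 x)
    (hρ : ContDiffOn ℝ 2 ρ Ω) (hu1 : ContDiffOn ℝ 2 u1 Ω)
    (hu2 : ContDiffOn ℝ 2 u2 Ω) (hu3 : ContDiffOn ℝ 2 u3 Ω)
    (hφ : ContDiffOn ℝ 2 φ Ω)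
    (hpC : ContDiffOn ℝ 2 p (Set.Ioi 0))
    (hp : ∀ r : ℝ, 0 < r → HasDerivAt p (p' r) r)
    (hh : ∀ r : ℝ, 0 < r → HasDerivAt h (p' r / r) r)
    (hcont : ∀ x ∈ Ω,
      pd 0 (fun y => ρ y * u1 y) x + pd 1 (fun y => ρ y * u2 y) x
        + pd 2 (fun y => ρ y * u3 y) x = 0)
    (hmom1 : ∀ x ∈ Ω,
      pd 0 (fun y => ρ y * u1 y * u1 y) x + pd 1 (fun y => ρ y * u1 y * u2 y) x
        + pd 2 (fun y => ρ y * u1 y * u3 y) x + pd 0 (fun y => p (ρ y)) x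
        = ρ x * pd 0 φ x)
    (hmom2 : ∀ x ∈ Ω,
      pd 0 (fun y => ρ y * u2 y * u1 y) x + pd 1 (fun y => ρ y * u2 y * u2 y) x
        + pd 2 (fun y => ρ y * u2 y * u3 y) x + pd 1 (fun y => p (ρ y)) x
        = ρ x * pd 1 φ x)
    (hmom3 : ∀ x ∈ Ω,
      pd 0 (fun y => ρ y * u3 y * u1 y) x + pd 1 (fun y => ρ y * u3 y * u2 y) x
        + pd 2 (fun y => ρ y * u3 y * u3 y) x + pd 2 (fun y => p (ρ y)) x
        = ρ x * pd 2 φ x) :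
    ∀ x ∈ Ω,
      Dop u1 u2 u3 (fun y => Wfun u1 u2 u3 y / (ρ y * Gfun u1 u2 u3 y)) x
        + (1 / (2 * ρ x * (Bfun ρ u1 u2 u3 φ h x + φ x - h (ρ x)) ^ 2)) *
          ( ((p' (ρ x) / ρ x) * pd 1 ρ x - pd 1 φ x) * pd 2 (Bfun ρ u1 u2 u3 φ h) x
              - ((p' (ρ x) / ρ x) * pd 2 ρ x - pd 2 φ x) * pd 1 (Bfun ρ u1 u2 u3 φ h) x
            + beta2 u1 u2 x *
              ( ((p' (ρ x) / ρ x) * pd 2 ρ x - pd 2 φ x) * pd 0 (Bfun ρ u1 u2 u3 φ h) x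
                - ((p' (ρ x) / ρ x) * pd 0 ρ x - pd 0 φ x) * pd 2 (Bfun ρ u1 u2 u3 φ h) x )
            + beta3 u1 u3 x *
              ( ((p' (ρ x) / ρ x) * pd 0 ρ x - pd 0 φ x) * pd 1 (Bfun ρ u1 u2 u3 φ h) x
                - ((p' (ρ x) / ρ x) * pd 1 ρ x - pd 1 φ x) * pd 0 (Bfun ρ u1 u2 u3 φ h) x ) )
        = 0 := by
  have nh : ∀ x ∈ Ω, Ω ∈ nhds x := fun x hx => hΩ.mem_nhds hx
  have cρ : ∀ x ∈ Ω, ContDiffAt ℝ 2 ρ x := fun x hx => hρ.contDiffAt (nh x hx)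
  have c1 : ∀ x ∈ Ω, ContDiffAt ℝ 2 u1 x := fun x hx => hu1.contDiffAt (nh x hx)
  have c2 : ∀ x ∈ Ω, ContDiffAt ℝ 2 u2 x := fun x hx => hu2.contDiffAt (nh x hx)
  have c3 : ∀ x ∈ Ω, ContDiffAt ℝ 2 u3 x := fun x hx => hu3.contDiffAt (nh x hx)
  have cφ : ∀ x ∈ Ω, ContDiffAt ℝ 2 φ x := fun x hx => hφ.contDiffAt (nh x hx)
  have two : (2 : WithTop ℕ∞) ≠ 0 := by norm_num
  -- the enthalpy is C²
  have hp'C : ContDiffOn ℝ 1 p' (Set.Ioi 0) := by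
    have h1 : ContDiffOn ℝ 1 (deriv p) (Set.Ioi 0) :=
      hpC.deriv_of_isOpen isOpen_Ioi (by norm_num)
    exact h1.congr fun r hr => (hp r hr).deriv.symm
  have hhC : ContDiffOn ℝ 2 h (Set.Ioi 0) := by
    have e : (2 : WithTop ℕ∞) = 1 + 1 := by norm_num
    rw [e, contDiffOn_succ_iff_deriv_of_isOpen isOpen_Ioi]
    refine ⟨fun r hr => (hh r hr).differentiableAt.differentiableWithinAt, by simp, ?_⟩
    have h2 : ContDiffOn ℝ 1 (fun r => p' r / r) (Set.Ioi 0) :=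
      hp'C.div contDiffOn_id fun r hr => ne_of_gt hr
    exact h2.congr fun r hr => (hh r hr).deriv
  set s : (Fin 3 → ℝ) → ℝ := fun y => h (ρ y) - φ y with hs
  have chρ : ∀ x ∈ Ω, ContDiffAt ℝ 2 (fun y => h (ρ y)) x := fun x hx =>
    (hhC.contDiffAt (isOpen_Ioi.mem_nhds (hρpos x hx))).comp x (cρ x hx)
  have cs : ∀ x ∈ Ω, ContDiffAt ℝ 2 s x := fun x hx => (chρ x hx).sub (cφ x hx)
  have hds : ∀ x ∈ Ω, ∀ i, pd i s x = p' (ρ x) / ρ x * pd i ρ x - pd i φ x := by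
    intro x hx i
    rw [hs, pd_sub i ((chρ x hx).differentiableAt two) ((cφ x hx).differentiableAt two),
      pd_comp i (hh _ (hρpos x hx)) ((cρ x hx).differentiableAt two)]
  -- continuity equation, expanded
  have hC : ∀ x ∈ Ω, u1 x * pd 0 ρ x + u2 x * pd 1 ρ x + u3 x * pd 2 ρ x
      + ρ x * (pd 0 u1 x + pd 1 u2 x + pd 2 u3 x) = 0 := by
    intro x hx
    have dρ := (cρ x hx).differentiableAt two
    have d1 := (c1 x hx).differentiableAt two
    have d2 := (c2 x hx).differentiableAt two
    have d3 := (c3 x hx).differentiableAt two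
    have := hcont x hx
    rw [pd_mul 0 dρ d1, pd_mul 1 dρ d2, pd_mul 2 dρ d3] at this
    linear_combination this
  have hM1 : ∀ x ∈ Ω, u1 x * pd 0 u1 x + u2 x * pd 1 u1 x + u3 x * pd 2 u1 x
      + pd 0 s x = 0 := by
    intro x hx
    have dρ := (cρ x hx).differentiableAt two
    have d1 := (c1 x hx).differentiableAt two
    have d2 := (c2 x hx).differentiableAt two
    have d3 := (c3 x hx).differentiableAt two
    have h0 := (hρpos x hx).ne'
    have e := hmom1 x hx
    rw [pd_mul 0 (dρ.fun_mul d1) d1, pd_mul 1 (dρ.fun_mul d1) d2,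
      pd_mul 2 (dρ.fun_mul d1) d3, pd_mul 0 dρ d1, pd_mul 1 dρ d1, pd_mul 2 dρ d1,
      pd_comp 0 (hp _ (hρpos x hx)) dρ] at e
    rw [hds x hx]
    apply mul_left_cancel₀ h0
    have e2 : ρ x * (p' (ρ x) / ρ x) = p' (ρ x) := by field_simp
    linear_combination e - u1 x * hC x hx + pd 0 ρ x * e2
  have hM2 : ∀ x ∈ Ω, u1 x * pd 0 u2 x + u2 x * pd 1 u2 x + u3 x * pd 2 u2 x
      + pd 1 s x = 0 := by
    intro x hx
    have dρ := (cρ x hx).differentiableAt two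
    have d1 := (c1 x hx).differentiableAt two
    have d2 := (c2 x hx).differentiableAt two
    have d3 := (c3 x hx).differentiableAt two
    have h0 := (hρpos x hx).ne'
    have e := hmom2 x hx
    rw [pd_mul 0 (dρ.fun_mul d2) d1, pd_mul 1 (dρ.fun_mul d2) d2,
      pd_mul 2 (dρ.fun_mul d2) d3, pd_mul 0 dρ d2, pd_mul 1 dρ d2, pd_mul 2 dρ d2,
      pd_comp 1 (hp _ (hρpos x hx)) dρ] at e
    rw [hds x hx]
    apply mul_left_cancel₀ h0
    have e2 : ρ x * (p' (ρ x) / ρ x) = p' (ρ x) := by field_simp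
    linear_combination e - u2 x * hC x hx + pd 1 ρ x * e2
  have hM3 : ∀ x ∈ Ω, u1 x * pd 0 u3 x + u2 x * pd 1 u3 x + u3 x * pd 2 u3 x
      + pd 2 s x = 0 := by
    intro x hx
    have dρ := (cρ x hx).differentiableAt two
    have d1 := (c1 x hx).differentiableAt two
    have d2 := (c2 x hx).differentiableAt two
    have d3 := (c3 x hx).differentiableAt two
    have h0 := (hρpos x hx).ne'
    have e := hmom3 x hx
    rw [pd_mul 0 (dρ.fun_mul d3) d1, pd_mul 1 (dρ.fun_mul d3) d2,
      pd_mul 2 (dρ.fun_mul d3) d3, pd_mul 0 dρ d3, pd_mul 1 dρ d3, pd_mul 2 dρ d3,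
      pd_comp 2 (hp _ (hρpos x hx)) dρ] at e
    rw [hds x hx]
    apply mul_left_cancel₀ h0
    have e2 : ρ x * (p' (ρ x) / ρ x) = p' (ρ x) := by field_simp
    linear_combination e - u3 x * hC x hx + pd 2 ρ x * e2
  intro x hx
  have dρ := (cρ x hx).differentiableAt two
  have d1 := (c1 x hx).differentiableAt two
  have d2 := (c2 x hx).differentiableAt two
  have d3 := (c3 x hx).differentiableAt two
  have ds := (cs x hx).differentiableAt two
  have g1 := fun i => pd_differentiableAt i (c1 x hx)
  have g2 := fun i => pd_differentiableAt i (c2 x hx)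
  have g3 := fun i => pd_differentiableAt i (c3 x hx)
  have gs := fun i => pd_differentiableAt i (cs x hx)
  have hD1 : ∀ k, (pd k u1 x * pd 0 u1 x + u1 x * pd k (pd 0 u1) x)
      + (pd k u2 x * pd 1 u1 x + u2 x * pd k (pd 1 u1) x)
      + (pd k u3 x * pd 2 u1 x + u3 x * pd k (pd 2 u1) x) + pd k (pd 0 s) x = 0 := by
    intro k
    have e : pd k (fun y => (u1 y * pd 0 u1 y + u2 y * pd 1 u1 y + u3 y * pd 2 u1 y)
        + pd 0 s y) x = 0 := by
      rw [← pd_const (x := x) k 0]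
      apply pd_congr
      filter_upwards [nh x hx] with y hy using hM1 y hy
    rw [pd_add k (((d1.fun_mul (g1 0)).fun_add (d2.fun_mul (g1 1))).fun_add
      (d3.fun_mul (g1 2))) (gs 0), pd_dot k d1 d2 d3 (g1 0) (g1 1) (g1 2)] at e
    exact e
  have hD2 : ∀ k, (pd k u1 x * pd 0 u2 x + u1 x * pd k (pd 0 u2) x)
      + (pd k u2 x * pd 1 u2 x + u2 x * pd k (pd 1 u2) x)
      + (pd k u3 x * pd 2 u2 x + u3 x * pd k (pd 2 u2) x) + pd k (pd 1 s) x = 0 := by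
    intro k
    have e : pd k (fun y => (u1 y * pd 0 u2 y + u2 y * pd 1 u2 y + u3 y * pd 2 u2 y)
        + pd 1 s y) x = 0 := by
      rw [← pd_const (x := x) k 0]
      apply pd_congr
      filter_upwards [nh x hx] with y hy using hM2 y hy
    rw [pd_add k (((d1.fun_mul (g2 0)).fun_add (d2.fun_mul (g2 1))).fun_add
      (d3.fun_mul (g2 2))) (gs 1), pd_dot k d1 d2 d3 (g2 0) (g2 1) (g2 2)] at e
    exact e
  have hD3 : ∀ k, (pd k u1 x * pd 0 u3 x + u1 x * pd k (pd 0 u3) x)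
      + (pd k u2 x * pd 1 u3 x + u2 x * pd k (pd 1 u3) x)
      + (pd k u3 x * pd 2 u3 x + u3 x * pd k (pd 2 u3) x) + pd k (pd 2 s) x = 0 := by
    intro k
    have e : pd k (fun y => (u1 y * pd 0 u3 y + u2 y * pd 1 u3 y + u3 y * pd 2 u3 y)
        + pd 2 s y) x = 0 := by
      rw [← pd_const (x := x) k 0]
      apply pd_congr
      filter_upwards [nh x hx] with y hy using hM3 y hy
    rw [pd_add k (((d1.fun_mul (g3 0)).fun_add (d2.fun_mul (g3 1))).fun_add
      (d3.fun_mul (g3 2))) (gs 2), pd_dot k d1 d2 d3 (g3 0) (g3 1) (g3 2)] at e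
    exact e
  have hB : ∀ i, pd i (Bfun ρ u1 u2 u3 φ h) x
      = u1 x * pd i u1 x + u2 x * pd i u2 x + u3 x * pd i u3 x + pd i s x := by
    intro i
    have e : Bfun ρ u1 u2 u3 φ h
        = fun y => (1 / 2 : ℝ) * (u1 y * u1 y + u2 y * u2 y + u3 y * u3 y) + s y := by
      funext y
      simp only [Bfun, hs]
      ring
    have dq := ((d1.fun_mul d1).fun_add (d2.fun_mul d2)).fun_add (d3.fun_mul d3)
    rw [e, pd_add i ((differentiableAt_const _).fun_mul dq) ds,
      pd_mul i (differentiableAt_const _) dq, pd_const, pd_dot i d1 d2 d3 d1 d2 d3]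
    ring
  have hH : ∀ i, pd i (fun y => Wfun u1 u2 u3 y / (ρ y * Gfun u1 u2 u3 y)) x
      = pd i (fun y => (u1 y * (pd 1 u3 y - pd 2 u2 y) + u2 y * (pd 2 u1 y - pd 0 u3 y)
        + u3 y * (pd 0 u2 y - pd 1 u1 y))
        / (ρ y * (u1 y * u1 y + u2 y * u2 y + u3 y * u3 y))) x := by
    intro i
    apply pd_congr
    filter_upwards [nh x hx] with y hy
    have e1 := (c1 y hy).differentiableAt two
    have e2 := (c2 y hy).differentiableAt two
    have e3 := (c3 y hy).differentiableAt two
    have p1 := hu1pos y hy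
    have p2 := hρpos y hy
    have k2 : ∀ j, pd j (beta2 u1 u2) y = (pd j u2 y * u1 y - u2 y * pd j u1 y) / u1 y ^ 2 :=
      fun j => pd_div j e2 e1 p1.ne'
    have k3 : ∀ j, pd j (beta3 u1 u3) y = (pd j u3 y * u1 y - u3 y * pd j u1 y) / u1 y ^ 2 :=
      fun j => pd_div j e3 e1 p1.ne'
    have eW : Wfun u1 u2 u3 y = (u1 y * (pd 1 u3 y - pd 2 u2 y) + u2 y * (pd 2 u1 y - pd 0 u3 y)
        + u3 y * (pd 0 u2 y - pd 1 u1 y)) / u1 y ^ 2 := by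
      simp only [Wfun, k2, k3, beta2, beta3]
      field_simp
      ring
    have eG : Gfun u1 u2 u3 y = (u1 y * u1 y + u2 y * u2 y + u3 y * u3 y) / u1 y ^ 2 := by
      simp only [Gfun, beta2, beta3]
      field_simp
    have q0 : 0 < u1 y * u1 y + u2 y * u2 y + u3 y * u3 y := by
      linarith [mul_pos p1 p1, mul_self_nonneg (u2 y), mul_self_nonneg (u3 y)]
    rw [eW, eG]
    generalize u1 y * u1 y + u2 y * u2 y + u3 y * u3 y = Q at *
    field_simp
  have p1 := hu1pos x hx
  have p2 := hρpos x hx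
  have q0 : 0 < u1 x * u1 x + u2 x * u2 x + u3 x * u3 x := by
      linarith [mul_pos p1 p1, mul_self_nonneg (u2 x), mul_self_nonneg (u3 x)]
  have w1 := (g3 1).fun_sub (g2 2)
  have w2 := (g1 2).fun_sub (g3 0)
  have w3 := (g2 0).fun_sub (g1 1)
  have dN := ((d1.fun_mul w1).fun_add (d2.fun_mul w2)).fun_add (d3.fun_mul w3)
  have dq := ((d1.fun_mul d1).fun_add (d2.fun_mul d2)).fun_add (d3.fun_mul d3)
  have hHx : ∀ i, pd i (fun y => Wfun u1 u2 u3 y / (ρ y * Gfun u1 u2 u3 y)) x = _ :=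
    fun i => (hH i).trans (pd_div i dN (dρ.fun_mul dq) (mul_pos p2 q0).ne')
  simp only [pd_dot _ d1 d2 d3 w1 w2 w3, pd_mul _ dρ dq, pd_dot _ d1 d2 d3 d1 d2 d3,
    pd_sub _ (g3 1) (g2 2), pd_sub _ (g1 2) (g3 0), pd_sub _ (g2 0) (g1 1)] at hHx
  have hBx : Bfun ρ u1 u2 u3 φ h x + φ x - h (ρ x)
      = (u1 x * u1 x + u2 x * u2 x + u3 x * u3 x) / 2 := by
    simp only [Bfun]
    ring
  simp only [Dop, hHx, hBx, hB, ← hds x hx, beta2, beta3]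
  have Sa01 := pd_symm 1 0 (c1 x hx)
  have Sa02 := pd_symm 2 0 (c1 x hx)
  have Sa12 := pd_symm 2 1 (c1 x hx)
  have Sb01 := pd_symm 1 0 (c2 x hx)
  have Sb02 := pd_symm 2 0 (c2 x hx)
  have Sb12 := pd_symm 2 1 (c2 x hx)
  have Sc01 := pd_symm 1 0 (c3 x hx)
  have Sc02 := pd_symm 2 0 (c3 x hx)
  have Sc12 := pd_symm 2 1 (c3 x hx)
  have Ss01 := pd_symm 1 0 (cs x hx)
  have Ss02 := pd_symm 2 0 (cs x hx)
  have Ss12 := pd_symm 2 1 (cs x hx)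
  have C := hC x hx
  have M1 := hM1 x hx
  have D10 := hD1 0
  have D11 := hD1 1
  have D12 := hD1 2
  have M2 := hM2 x hx
  have D20 := hD2 0
  have D21 := hD2 1
  have D22 := hD2 2
  have M3 := hM3 x hx
  have D30 := hD3 0
  have D31 := hD3 1
  have D32 := hD3 2
  simp only [Sa01, Sa02, Sa12, Sb01, Sb02, Sb12, Sc01, Sc02, Sc12, Ss01, Ss02, Ss12]
    at D10 D11 D12 D20 D21 D22 D30 D31 D32 ⊢
  apply final_alg _ _ _ _ _ _ _ _ _ _ _ p1.ne' p2.ne' q0.ne'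
  linear_combination
    ρ x * (u1 x * u1 x + u2 x * u2 x + u3 x * u3 x) * (u1 x * (D31 - D22) + u2 x * (D12 - D30) + u3 x * (D20 - D11))
    - (u1 x * (pd 1 u3 x - pd 2 u2 x) + u2 x * (pd 2 u1 x - pd 0 u3 x) + u3 x * (pd 0 u2 x - pd 1 u1 x)) * (u1 x * u1 x + u2 x * u2 x + u3 x * u3 x) * C
    + (2 * ρ x * (u1 x * u1 x + u2 x * u2 x + u3 x * u3 x) * (pd 1 u3 x - pd 2 u2 x) - 2 * ρ x * (u1 x * (pd 1 u3 x - pd 2 u2 x) + u2 x * (pd 2 u1 x - pd 0 u3 x) + u3 x * (pd 0 u2 x - pd 1 u1 x)) * u1 x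
      + 2 * ρ x * (u2 x * pd 2 s x - u3 x * pd 1 s x)) * M1
    + (2 * ρ x * (u1 x * u1 x + u2 x * u2 x + u3 x * u3 x) * (pd 2 u1 x - pd 0 u3 x) - 2 * ρ x * (u1 x * (pd 1 u3 x - pd 2 u2 x) + u2 x * (pd 2 u1 x - pd 0 u3 x) + u3 x * (pd 0 u2 x - pd 1 u1 x)) * u2 x
      + 2 * ρ x * (u3 x * pd 0 s x - u1 x * pd 2 s x)) * M2
    + (2 * ρ x * (u1 x * u1 x + u2 x * u2 x + u3 x * u3 x) * (pd 0 u2 x - pd 1 u1 x) - 2 * ρ x * (u1 x * (pd 1 u3 x - pd 2 u2 x) + u2 x * (pd 2 u1 x - pd 0 u3 x) + u3 x * (pd 0 u2 x - pd 1 u1 x)) * u3 x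
      + 2 * ρ x * (u1 x * pd 1 s x - u2 x * pd 0 s x)) * M3
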